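/- arXiv:1906.09049 — 4 statements merged into one kernel-verified Lean document; each statement's English description precedes it below -/
import Mathlib

section
/- Let u, v be nonzero complex numbers with u + v ≠ 0. Then the rational R-matrices on (ℂ²)^{⊗3} satisfy the Yang–Baxter equation: R₁₂(u) · R₁₃(u+v) · R₂₃(v) = R₂₃(v) · R₁₃(u+v) · R₁₂(u), as an identity of 8×8 complex matrices. -/
/-- The operator on `(ℂ²)^{⊗ n}` exchanging the `k`-th and `l`-th tensor factors,
as a permutation matrix on the standard basis indexed by `Fin n → Fin 2`. -/
def Pmat (n : ℕ) (k l : Fin n) : Matrix (Fin n → Fin 2) (Fin n → Fin 2) ℂ :=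
  Matrix.of fun f g => if g = f ∘ (Equiv.swap k l) then 1 else 0

/-- The rational R-matrix `R_{kl}(u) = 1 - u⁻¹ • P_{kl}`. -/
noncomputable def Rmat (n : ℕ) (k l : Fin n) (u : ℂ) : Matrix (Fin n → Fin 2) (Fin n → Fin 2) ℂ :=
  1 - u⁻¹ • Pmat n k l

/-- The operator permuting the tensor factors of `(ℂ²)^{⊗ n}` by `σ`. -/
def tensorPerm (n : ℕ) (σ : Equiv.Perm (Fin n)) :
    Matrix (Fin n → Fin 2) (Fin n → Fin 2) ℂ :=
  Matrix.of fun f g => if g = f ∘ σ then 1 else 0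

theorem tensorPerm_mul (n : ℕ) (σ τ : Equiv.Perm (Fin n)) :
    tensorPerm n σ * tensorPerm n τ = tensorPerm n (σ * τ) := by
  ext f g
  simp only [tensorPerm, Matrix.mul_apply, Matrix.of_apply, ite_mul, one_mul, zero_mul,
    Finset.sum_ite_eq', Finset.mem_univ, if_true, Equiv.Perm.coe_mul,
    Function.comp_assoc]
  congr

theorem Pmat_eq_tensorPerm (n : ℕ) (k l : Fin n) :
    Pmat n k l = tensorPerm n (Equiv.swap k l) := rfl

/-- The Yang–Baxter equation for `1 - a • A`, `1 - b • B`, `1 - c • C`, where `A`, `B`, `C`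
multiply like the three transpositions in `S₃`. -/
theorem yang_baxter_of_transposition_relations {K M : Type*} [CommRing K] [Ring M] [Algebra K M]
    {a b c : K} {A B C : M} (habc : a * c = a * b + b * c)
    (hAB : A * B = C * A) (hBC : B * C = C * A) (hBA : B * A = A * C) (hCB : C * B = A * C)
    (hABC : A * B * C = C * B * A) :
    (1 - a • A) * (1 - b • B) * (1 - c • C) = (1 - c • C) * (1 - b • B) * (1 - a • A) := by
  simp only [sub_mul, mul_sub, one_mul, mul_one, smul_mul_assoc, mul_smul_comm, hABC]
  simp only [hAB, hBC, hBA, hCB]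
  match_scalars <;> first | ring1 | linear_combination habc | linear_combination -habc

/-- The Yang–Baxter equation for the rational R-matrices on `(ℂ²)^{⊗3}`:
`R₁₂(u) R₁₃(u+v) R₂₃(v) = R₂₃(v) R₁₃(u+v) R₁₂(u)` (tensor positions 1,2,3 are
`0,1,2 : Fin 3`). -/
theorem yang_baxter_equation (u v : ℂ) (hu : u ≠ 0) (hv : v ≠ 0) (huv : u + v ≠ 0) :
    Rmat 3 0 1 u * Rmat 3 0 2 (u + v) * Rmat 3 1 2 v =
      Rmat 3 1 2 v * Rmat 3 0 2 (u + v) * Rmat 3 0 1 u := by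
  have hinv : u⁻¹ * v⁻¹ = u⁻¹ * (u + v)⁻¹ + (u + v)⁻¹ * v⁻¹ := by
    field_simp
    ring
  unfold Rmat
  simp only [Pmat_eq_tensorPerm]
  apply yang_baxter_of_transposition_relations hinv <;> simp only [tensorPerm_mul] <;>
    congr 1 <;> decide
end

section
/- Let R be a commutative ring, n ≥ 1, and a : Fin n → R. Let K be the n×n matrix over R whose (i, j) entry (rows i ∈ Fin n, columns j ∈ {0, 1, …, n−1}) is the j-th elementary symmetric function e_j of the n−1 values (a_k)_{k ≠ i}. Then det K = ∏_{i < j} (a_i − a_j). -/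
/-- The defining recursion of the elementary symmetric functions. -/
theorem Multiset.esymm_cons_add_one {R : Type*} [CommSemiring R] (x : R) (s : Multiset R)
    (k : ℕ) : (x ::ₘ s).esymm (k + 1) = s.esymm (k + 1) + x * s.esymm k := by
  simp [Multiset.esymm, Multiset.powersetCard_cons, Multiset.sum_map_mul_left]

/-- The elementary symmetric functions of a family with one member removed, in terms of those of
the whole family. -/
theorem Multiset.esymm_eq_sum_neg_pow_mul_esymm_cons {R : Type*} [CommRing R] (x : R)
    (s : Multiset R) (k : ℕ) :
    s.esymm k = ∑ m ∈ Finset.range (k + 1), (-x) ^ m * (x ::ₘ s).esymm (k - m) := by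
  induction k with
  | zero => simp [Multiset.esymm]
  | succ k ih =>
    rw [Finset.sum_range_succ']
    simp only [Nat.add_sub_add_right, pow_succ', mul_assoc, ← Finset.mul_sum, ← ih]
    simp [Multiset.esymm_cons_add_one]

/-- Let `R` be a commutative ring, `n ≥ 1`, and `a : Fin n → R`. Let `K` be the
`n×n` matrix whose `(i,j)` entry is the `j`-th elementary symmetric function of the
`n-1` values `(a_k)_{k ≠ i}`. Then `det K = ∏_{i<j} (a_i - a_j)`. -/
theorem det_esymm_matrix {R : Type*} [CommRing R] (n : ℕ) (hn : 1 ≤ n)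
    (a : Fin n → R) :
    (Matrix.of fun i j : Fin n =>
        ((Finset.univ.erase i).val.map a).esymm (j : ℕ)).det =
      ∏ p ∈ Finset.univ.filter (fun p : Fin n × Fin n => p.1 < p.2),
        (a p.1 - a p.2) := by
  let U : Matrix (Fin n) (Fin n) R := Matrix.of fun m j =>
    if m ≤ j then (Finset.univ.val.map a).esymm ((j : ℕ) - m) else 0
  have hU : U.det = 1 := by
    rw [Matrix.det_of_isUpperTriangular]
    · simp [U, Multiset.esymm]
    · intro i j hij
      exact if_neg (not_le.mpr hij)
  have hK : (Matrix.of fun i j : Fin n => ((Finset.univ.erase i).val.map a).esymm (j : ℕ)) =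
      Matrix.vandermonde (fun i => -a i) * U := by
    ext i j
    have hcons : a i ::ₘ (Finset.univ.erase i).val.map a = Finset.univ.val.map a := by
      rw [← Multiset.map_cons, Finset.erase_val, Multiset.cons_erase (Finset.mem_univ i)]
    rw [Matrix.of_apply, Multiset.esymm_eq_sum_neg_pow_mul_esymm_cons (a i), hcons,
      Matrix.mul_apply]
    simp only [U, Matrix.vandermonde_apply, Matrix.of_apply, Fin.le_def, mul_ite, mul_zero]
    rw [Fin.sum_univ_eq_sum_range (fun m => if m ≤ (j : ℕ) then
      (-a i) ^ m * (Finset.univ.val.map a).esymm ((j : ℕ) - m) else 0) n, ← Finset.sum_filter]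
    congr 1
    ext m
    simp only [Finset.mem_range, Finset.mem_filter]
    omega
  rw [hK, Matrix.det_mul, hU, mul_one, Matrix.det_vandermonde, Finset.prod_sigma']
  refine Finset.prod_bij' (fun p _ => (p.1, p.2)) (fun p _ => ⟨p.1, p.2⟩) ?_ ?_ ?_ ?_ ?_ <;>
    simp [neg_add_eq_sub]
end

section
/- Fix a, b ∈ ℂ and an integer m ≥ 1. With V, the basis vectors w_{i,j}, the operators T₁, T₂, and the degree-m subspace V_m as in the context, the space {v ∈ V_m : T₁ v = 0 and T₂ v = 0} is equal to the one-dimensional span of v_m := ∑_{i=0}^{m} (−1)^i w_{i, m−i} if a − b = m − 1, and is equal to {0} otherwise. In particular, a nonzero simultaneous kernel vector in V_m exists if and only if a − b = m − 1. -/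
/-- The complex vector space with basis `{w_{i,j} : i, j ∈ ℕ}`. -/
abbrev V : Type := (ℕ × ℕ) →₀ ℂ

/-- The basis vector `w_{i,j}`. -/
noncomputable def w (i j : ℕ) : V := Finsupp.single (i, j) 1

/-- The operator `T₁` with `T₁ w_{i,j} = w_{i,j-1} + w_{i-1,j}`, terms with a negative
index being interpreted as `0` (coefficient of `u⁻¹` of `t₁₂(u)` on
`M^∨(a,·) ⊗ M^∨(·,b)`). -/
noncomputable def T1 : V →ₗ[ℂ] V :=
  Finsupp.lift V ℂ (ℕ × ℕ) fun p =>
    (if p.2 = 0 then 0 else w p.1 (p.2 - 1)) + (if p.1 = 0 then 0 else w (p.1 - 1) p.2)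

/-- The operator `T₂` with `T₂ w_{i,j} = (a-i) w_{i,j-1} + (b+j) w_{i-1,j}`, terms with a
negative index being interpreted as `0` (coefficient of `u⁻²` of `t₁₂(u)` on
`M^∨(a,·) ⊗ M^∨(·,b)`). -/
noncomputable def T2 (a b : ℂ) : V →ₗ[ℂ] V :=
  Finsupp.lift V ℂ (ℕ × ℕ) fun p =>
    (if p.2 = 0 then 0 else (a - (p.1 : ℂ)) • w p.1 (p.2 - 1)) +
      (if p.1 = 0 then 0 else (b + (p.2 : ℂ)) • w (p.1 - 1) p.2)

/-- The degree-`m` subspace `V_m`, spanned by the `w_{i,j}` with `i + j = m`. -/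
noncomputable def Vm (m : ℕ) : Submodule ℂ V :=
  Submodule.span ℂ {v : V | ∃ i j : ℕ, i + j = m ∧ v = w i j}

theorem T1_apply (v : V) (i j : ℕ) : T1 v (i, j) = v (i, j + 1) + v (i + 1, j) := by
  have h : Finsupp.lapply (i, j) ∘ₗ T1 =
      (Finsupp.lapply (i, j + 1) + Finsupp.lapply (i + 1, j) : V →ₗ[ℂ] ℂ) := by
    ext ⟨k, l⟩
    rcases k with _ | k <;> rcases l with _ | l <;>
      simp [T1, w, Finsupp.single_apply]
  exact LinearMap.congr_fun h v

theorem T2_apply (a b : ℂ) (v : V) (i j : ℕ) :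
    T2 a b v (i, j) = (a - i) * v (i, j + 1) + (b + j) * v (i + 1, j) := by
  have h : Finsupp.lapply (i, j) ∘ₗ T2 a b =
      ((a - i) • Finsupp.lapply (i, j + 1) + (b + j) • Finsupp.lapply (i + 1, j) :
        V →ₗ[ℂ] ℂ) := by
    ext ⟨k, l⟩
    rcases k with _ | k <;> rcases l with _ | l <;>
      simp [T2, w, Finsupp.single_apply] <;> split_ifs <;> aesop
  exact LinearMap.congr_fun h v

theorem mem_Vm_iff (m : ℕ) (v : V) : v ∈ Vm m ↔ ∀ i j, i + j ≠ m → v (i, j) = 0 := by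
  have h : Vm m = Finsupp.supported ℂ ℂ {p : ℕ × ℕ | p.1 + p.2 = m} := by
    rw [Finsupp.supported_eq_span_single, Vm]
    congr 1
    ext x
    simp [w, eq_comm]
  rw [h, Finsupp.mem_supported']
  simp

/-- The alternating sum `∑ (-1)^i w_{i,m-i}` has coefficient `(-1)^i` at `w_{i,j}` for
`i + j = m` and no other terms. -/
theorem alternating_sum_apply (m i j : ℕ) :
    (∑ k ∈ Finset.range (m + 1), (-1 : ℂ) ^ k • w k (m - k)) (i, j) =
      if i + j = m then (-1) ^ i else 0 := by
  rw [Finsupp.finsetSum_apply]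
  split_ifs with h
  · rw [Finset.sum_eq_single i]
    · simp [w, ← h]
    · intro k _ hk
      simp [w, hk]
    · intro hi
      exact absurd (Finset.mem_range.2 (by omega)) hi
  · refine Finset.sum_eq_zero fun k hk => ?_
    have hk' := Finset.mem_range.1 hk
    have : ¬ (k = i ∧ m - k = j) := by omega
    simp [w, this]

/-- The kernel of `T₁` on `V_m` is spanned by the alternating sum. -/
theorem eq_smul_of_T1_eq_zero {m : ℕ} {v : V} (hv : v ∈ Vm m) (h1 : T1 v = 0) :
    v = v (0, m) • ∑ k ∈ Finset.range (m + 1), (-1 : ℂ) ^ k • w k (m - k) := by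
  rw [mem_Vm_iff] at hv
  have key : ∀ i j, i + j = m → v (i, j) = v (0, m) * (-1) ^ i := by
    intro i
    induction i with
    | zero => rintro j rfl; simp
    | succ i ih =>
      intro j hij
      have h := T1_apply v i j
      rw [h1, Finsupp.zero_apply, ih (j + 1) (by omega)] at h
      rw [pow_succ]
      linear_combination -h
  ext ⟨i, j⟩
  rw [Finsupp.smul_apply, alternating_sum_apply, smul_eq_mul]
  split_ifs with h
  · exact key i j h
  · rw [hv i j h, mul_zero]

theorem sub_eq_of_ne_zero {a b : ℂ} {m : ℕ} (hm : 1 ≤ m) {v : V} (hv : v ∈ Vm m)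
    (h1 : T1 v = 0) (h2 : T2 a b v = 0) (h0 : v ≠ 0) : a - b = (m : ℂ) - 1 := by
  obtain ⟨n, rfl⟩ := Nat.exists_eq_add_of_le' hm
  have hc : v (0, n + 1) ≠ 0 := by
    intro hc
    apply h0
    rw [eq_smul_of_T1_eq_zero hv h1, hc, zero_smul]
  have e1 := T1_apply v 0 n
  have e2 := T2_apply a b v 0 n
  rw [h1, Finsupp.zero_apply] at e1
  rw [h2, Finsupp.zero_apply] at e2
  apply mul_right_cancel₀ hc
  push_cast at e2 ⊢
  linear_combination (b + n) * e1 - e2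

theorem alternating_sum_mem_Vm (m : ℕ) :
    ∑ k ∈ Finset.range (m + 1), (-1 : ℂ) ^ k • w k (m - k) ∈ Vm m := by
  rw [mem_Vm_iff]
  intro i j h
  rw [alternating_sum_apply, if_neg h]

theorem T1_alternating_sum (m : ℕ) :
    T1 (∑ k ∈ Finset.range (m + 1), (-1 : ℂ) ^ k • w k (m - k)) = 0 := by
  ext ⟨i, j⟩
  rw [T1_apply, alternating_sum_apply, alternating_sum_apply, Finsupp.zero_apply,
    add_right_comm i 1 j, ← add_assoc]
  split_ifs <;> ring

theorem T2_alternating_sum {a b : ℂ} {m : ℕ} (hab : a - b = (m : ℂ) - 1) :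
    T2 a b (∑ k ∈ Finset.range (m + 1), (-1 : ℂ) ^ k • w k (m - k)) = 0 := by
  ext ⟨i, j⟩
  rw [T2_apply, alternating_sum_apply, alternating_sum_apply, Finsupp.zero_apply,
    add_right_comm i 1 j, ← add_assoc]
  split_ifs with h
  · rw [← h] at hab
    push_cast at hab
    linear_combination (-1) ^ i * hab
  · ring

theorem alternating_sum_ne_zero (m : ℕ) :
    ∑ k ∈ Finset.range (m + 1), (-1 : ℂ) ^ k • w k (m - k) ≠ 0 := by
  intro h
  simpa [h] using alternating_sum_apply m 0 m

open Classical in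
/-- For `m ≥ 1`, the space of simultaneous kernel vectors
`{v ∈ V_m : T₁ v = 0, T₂ v = 0}` equals the span of
`v_m = ∑_{i=0}^{m} (-1)^i w_{i,m-i}` if `a - b = m - 1`, and equals `{0}` otherwise.
In particular, a nonzero simultaneous kernel vector in `V_m` exists if and only if
`a - b = m - 1`. -/
theorem singular_vectors (a b : ℂ) (m : ℕ) (hm : 1 ≤ m) :
    ({v : V | v ∈ Vm m ∧ T1 v = 0 ∧ T2 a b v = 0} =
      if a - b = (m : ℂ) - 1 then
        (Submodule.span ℂ
          {∑ i ∈ Finset.range (m + 1), (-1 : ℂ) ^ i • w i (m - i)} : Set V)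
      else {0}) ∧
    ((∃ v : V, v ∈ Vm m ∧ T1 v = 0 ∧ T2 a b v = 0 ∧ v ≠ 0) ↔
      a - b = (m : ℂ) - 1) := by
  refine ⟨?_, fun ⟨v, hv, h1, h2, h0⟩ => sub_eq_of_ne_zero hm hv h1 h2 h0, fun hab =>
    ⟨_, alternating_sum_mem_Vm m, T1_alternating_sum m, T2_alternating_sum hab,
      alternating_sum_ne_zero m⟩⟩
  split_ifs with hab
  · ext v
    rw [SetLike.mem_coe, Submodule.mem_span_singleton]
    constructor
    · rintro ⟨hv, h1, -⟩
      exact ⟨_, (eq_smul_of_T1_eq_zero hv h1).symm⟩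
    · rintro ⟨c, rfl⟩
      refine ⟨Submodule.smul_mem _ c (alternating_sum_mem_Vm m), ?_, ?_⟩
      · rw [map_smul, T1_alternating_sum, smul_zero]
      · rw [map_smul, T2_alternating_sum hab, smul_zero]
  · ext v
    constructor
    · rintro ⟨hv, h1, h2⟩
      by_contra h0
      exact hab (sub_eq_of_ne_zero hm hv h1 h2 h0)
    · rintro rfl
      exact ⟨Submodule.zero_mem _, map_zero _, map_zero _⟩
end

section
/- Fix a, b ∈ ℂ and an integer m ≥ 1, and set v_m := ∑_{i=0}^{m} (−1)^i w_{i, m−i}. Then T₁ v_m = 0 and T₂ v_m = (a − b − m + 1) · ∑_{i=0}^{m−1} (−1)^i w_{i, m−1−i}. -/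
theorem T1_w (i j : ℕ) : T1 (w i j) =
    (if j = 0 then 0 else w i (j - 1)) + (if i = 0 then 0 else w (i - 1) j) := by
  rw [T1, w, Finsupp.lift_apply, Finsupp.sum_single_index (by rw [zero_smul]), one_smul]

theorem T2_w (a b : ℂ) (i j : ℕ) : T2 a b (w i j) =
    (if j = 0 then 0 else (a - (i : ℂ)) • w i (j - 1)) +
      (if i = 0 then 0 else (b + (j : ℂ)) • w (i - 1) j) := by
  rw [T2, w, Finsupp.lift_apply, Finsupp.sum_single_index (by rw [zero_smul]), one_smul]

/-- The lowering part in the second index vanishes on the last summand and the lowering part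
in the first index vanishes on the first one, so the two sums can be aligned. -/
theorem sum_alternating_lower (f g : ℕ → ℕ → V) (n : ℕ) :
    ∑ i ∈ Finset.range (n + 1 + 1), (-1 : ℂ) ^ i •
        ((if n + 1 - i = 0 then 0 else f i (n + 1 - i)) +
          (if i = 0 then 0 else g i (n + 1 - i))) =
      ∑ i ∈ Finset.range (n + 1), (-1 : ℂ) ^ i • (f i (n - i + 1) - g (i + 1) (n - i)) := by
  simp only [smul_add, Finset.sum_add_distrib]
  rw [Finset.sum_range_succ, Finset.sum_range_succ' _ (n + 1)]
  simp only [tsub_self, if_true, smul_zero, add_zero]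
  rw [← Finset.sum_add_distrib]
  refine Finset.sum_congr rfl fun i hi => ?_
  have hi' : i ≤ n := Nat.lt_succ_iff.mp (Finset.mem_range.mp hi)
  rw [if_neg (by lia), if_neg (by lia), Nat.add_sub_add_right, Nat.sub_add_comm hi', pow_succ,
    mul_neg_one, neg_smul, smul_sub, sub_eq_add_neg]

/-- For `m ≥ 1` and `v_m = ∑_{i=0}^{m} (-1)^i w_{i,m-i}`, one has `T₁ v_m = 0` and
`T₂ v_m = (a - b - m + 1) ∑_{i=0}^{m-1} (-1)^i w_{i,m-1-i}`. -/
theorem T1_T2_apply_vm (a b : ℂ) (m : ℕ) (hm : 1 ≤ m) :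
    T1 (∑ i ∈ Finset.range (m + 1), (-1 : ℂ) ^ i • w i (m - i)) = 0 ∧
    T2 a b (∑ i ∈ Finset.range (m + 1), (-1 : ℂ) ^ i • w i (m - i)) =
      (a - b - (m : ℂ) + 1) •
        ∑ i ∈ Finset.range m, (-1 : ℂ) ^ i • w i (m - 1 - i) := by
  obtain ⟨n, rfl⟩ := Nat.exists_eq_add_of_le' hm
  simp only [map_sum, map_smul, T1_w, T2_w]
  constructor
  · rw [sum_alternating_lower (fun i j => w i (j - 1)) (fun i j => w (i - 1) j)]
    simp
  · rw [sum_alternating_lower (fun i j => (a - (i : ℂ)) • w i (j - 1))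
      (fun i j => (b + (j : ℂ)) • w (i - 1) j), Finset.smul_sum]
    refine Finset.sum_congr rfl fun i hi => ?_
    have hi' : i ≤ n := Nat.lt_succ_iff.mp (Finset.mem_range.mp hi)
    simp only [Nat.add_sub_cancel, ← sub_smul, smul_smul]
    congr 1
    push_cast [Nat.cast_sub hi']
    ring
end
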